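/- Let ψ : ℝ² → ℝ be twice continuously differentiable and let θ > 0, λ, M be real numbers. Define Ξ(x) := θ · exp(λψ(x)) and Φ(x) := θ · (M − exp(λψ(x))). Then for every x ∈ ℝ²: −div(|∇Φ|²∇Φ)(x) − 2λ²·|∇ψ(x)|²·Ξ(x)·|∇Φ(x)|² = λ⁴·|∇ψ(x)|⁴·Ξ(x)³ + λ³·Ξ(x)³·div(|∇ψ|²∇ψ)(x). -/

import Mathlib

/-- Divergence of a vector field `V` at `x`: the trace of its Fréchet derivative. -/
noncomputable def divg (V : EuclideanSpace ℝ (Fin 2) → EuclideanSpace ℝ (Fin 2))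
    (x : EuclideanSpace ℝ (Fin 2)) : ℝ :=
  LinearMap.trace ℝ (EuclideanSpace ℝ (Fin 2)) (fderiv ℝ V x).toLinearMap

/-- The weight `Ξ(x) = θ e^{λψ(x)}`. -/
noncomputable def XiF (θ lam : ℝ) (ψ : EuclideanSpace ℝ (Fin 2) → ℝ)
    (x : EuclideanSpace ℝ (Fin 2)) : ℝ :=
  θ * Real.exp (lam * ψ x)

/-- The weight `Φ(x) = θ (M − e^{λψ(x)})`. -/
noncomputable def PhiF (θ lam M : ℝ) (ψ : EuclideanSpace ℝ (Fin 2) → ℝ)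
    (x : EuclideanSpace ℝ (Fin 2)) : ℝ :=
  θ * (M - Real.exp (lam * ψ x))

theorem divg_smul {f : EuclideanSpace ℝ (Fin 2) → ℝ}
    {V : EuclideanSpace ℝ (Fin 2) → EuclideanSpace ℝ (Fin 2)} {x : EuclideanSpace ℝ (Fin 2)}
    (hf : DifferentiableAt ℝ f x) (hV : DifferentiableAt ℝ V x) :
    divg (fun y => f y • V y) x = f x * divg V x + fderiv ℝ f x (V x) := by
  have h : ((fderiv ℝ f x).smulRight (V x)).toLinearMap
      = (fderiv ℝ f x).toLinearMap.smulRight (V x) := rfl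
  simp only [divg]
  rw [fderiv_fun_smul hf hV, ContinuousLinearMap.toLinearMap_add,
    ContinuousLinearMap.toLinearMap_smul, map_add, map_smul, h, LinearMap.trace_smulRight]
  simp

theorem hasFDerivAt_XiF {θ lam : ℝ} {ψ : EuclideanSpace ℝ (Fin 2) → ℝ}
    {x : EuclideanSpace ℝ (Fin 2)} (hψ : DifferentiableAt ℝ ψ x) :
    HasFDerivAt (XiF θ lam ψ) ((lam * XiF θ lam ψ x) • fderiv ℝ ψ x) x := by
  refine (((hψ.hasFDerivAt.const_mul lam).exp).const_mul θ).congr_fderiv ?_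
  ext v
  simp [XiF]
  ring

theorem gradient_PhiF {θ lam M : ℝ} {ψ : EuclideanSpace ℝ (Fin 2) → ℝ}
    {x : EuclideanSpace ℝ (Fin 2)} (hψ : DifferentiableAt ℝ ψ x) :
    gradient (PhiF θ lam M ψ) x = (-(lam * XiF θ lam ψ x)) • gradient ψ x := by
  have h : PhiF θ lam M ψ = fun y => θ * M - XiF θ lam ψ y := by
    funext y
    simp only [PhiF, XiF]
    ring
  rw [gradient, h, ((hasFDerivAt_XiF hψ).const_sub (θ * M)).fderiv, ← neg_smul, map_smulₛₗ]
  simp [gradient]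

/-- The pointwise algebraic identity (A.21) used for the positivity of the `s³`-order
terms in the Carleman estimate for the heat equation; it rests on `∇Φ = −λΞ∇ψ`. -/
theorem stmt_13
    (ψ : EuclideanSpace ℝ (Fin 2) → ℝ) (hψ : ContDiff ℝ 2 ψ)
    (θ lam M : ℝ) (hθ : 0 < θ) :
    ∀ x : EuclideanSpace ℝ (Fin 2),
      -(divg (fun y => ‖gradient (PhiF θ lam M ψ) y‖^2 • gradient (PhiF θ lam M ψ) y) x)
        - 2*lam^2*‖gradient ψ x‖^2 * XiF θ lam ψ x * ‖gradient (PhiF θ lam M ψ) x‖^2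
      = lam^4*‖gradient ψ x‖^4*(XiF θ lam ψ x)^3
        + lam^3*(XiF θ lam ψ x)^3 * divg (fun y => ‖gradient ψ y‖^2 • gradient ψ y) x := by
  intro x
  have hd : Differentiable ℝ ψ := hψ.differentiable (by norm_num)
  have hg : Differentiable ℝ (gradient ψ) :=
    (InnerProductSpace.toDual ℝ (EuclideanSpace ℝ (Fin 2))).symm.differentiable.comp
      ((hψ.fderiv_right (m := 1) (by norm_num)).differentiable (by norm_num))
  have hV : DifferentiableAt ℝ (fun y => ‖gradient ψ y‖ ^ 2 • gradient ψ y) x :=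
    ((hg x).norm_sq ℝ).smul (hg x)
  have hX := ((hasFDerivAt_XiF (θ := θ) (lam := lam) (hd x)).pow 3).const_mul (-lam ^ 3)
  have hG : (fun y => ‖gradient (PhiF θ lam M ψ) y‖ ^ 2 • gradient (PhiF θ lam M ψ) y)
      = fun y => (-lam ^ 3 * XiF θ lam ψ y ^ 3) • (‖gradient ψ y‖ ^ 2 • gradient ψ y) := by
    funext y
    rw [gradient_PhiF (hd y), norm_smul, mul_pow, Real.norm_eq_abs, sq_abs, smul_smul, smul_smul]
    congr 1
    ring
  have hD : fderiv ℝ ψ x (gradient ψ x) = ‖gradient ψ x‖ ^ 2 := by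
    rw [← real_inner_self_eq_norm_sq, gradient, InnerProductSpace.toDual_symm_apply]
  rw [hG, divg_smul hX.differentiableAt hV, hX.fderiv, gradient_PhiF (hd x), norm_smul, mul_pow,
    Real.norm_eq_abs, sq_abs]
  simp [hD]
  ring
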